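/- For any window size W ≥ 0, Σ_{i=1}^{L} min_{(j,k)∈ℛ^W_i} δ(A_j,B_k) ≤ DTW²_W(A,B). -/

import Mathlib

noncomputable section

/-- Squared pointwise cost. -/
def delta (x y : ℝ) : ℝ := (x - y) ^ 2

/-- Continuity/monotonicity step of a warping path. -/
def Step (q r : ℕ × ℕ) : Prop :=
  r = (q.1 + 1, q.2) ∨ r = (q.1, q.2 + 1) ∨ r = (q.1 + 1, q.2 + 1)

/-- A `W`-warping path for series of length `L` (1-based indices). -/
def IsWarpingPath (L W : ℕ) (p : List (ℕ × ℕ)) : Prop :=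
  p.head? = some (1, 1) ∧ p.getLast? = some (L, L) ∧ List.Chain' Step p ∧
    ∀ q ∈ p, 1 ≤ q.1 ∧ q.1 ≤ L ∧ 1 ≤ q.2 ∧ q.2 ≤ L ∧ ((q.1 : ℤ) - (q.2 : ℤ)).natAbs ≤ W

/-- Cost of a warping path. -/
def pathCost (A B : ℕ → ℝ) (p : List (ℕ × ℕ)) : ℝ :=
  (p.map (fun q => delta (A q.1) (B q.2))).sum

/-- `DTW²_W(A,B)`: minimum cost over all `W`-warping paths. -/
def DTW2 (L W : ℕ) (A B : ℕ → ℝ) : ℝ :=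
  sInf (pathCost A B '' {p | IsWarpingPath L W p})

/-- Left band `ℒ^W_i`. -/
def leftBand (W i : ℕ) : Finset (ℕ × ℕ) :=
  (Finset.Icc (max 1 (i - W)) i).image (fun j => (j, i)) ∪
    (Finset.Icc (max 1 (i - W)) i).image (fun k => (i, k))

/-- Right band `ℛ^W_i`. -/
def rightBand (L W i : ℕ) : Finset (ℕ × ℕ) :=
  (Finset.Icc i (min L (i + W))).image (fun j => (j, i)) ∪
    (Finset.Icc i (min L (i + W))).image (fun k => (i, k))

/-- Vertical band `𝒱_i`. -/
def vertBand (L W i : ℕ) : Finset (ℕ × ℕ) :=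
  (Finset.Icc (max 1 (i - W)) (min L (i + W))).image (fun j => (i, j))

/-- Minimum of `δ(A_j, B_k)` over a (finite, nonempty) band of pairs `(j,k)`. -/
def bandMin (A B : ℕ → ℝ) (s : Finset (ℕ × ℕ)) : ℝ :=
  sInf ((fun q => delta (A q.1) (B q.2)) '' (s : Set (ℕ × ℕ)))

/-- Upper envelope `𝕌^B_i`. -/
def upperEnv (L W : ℕ) (B : ℕ → ℝ) (i : ℕ) : ℝ :=
  sSup (B '' Set.Icc (max 1 (i - W)) (min L (i + W)))

/-- Lower envelope `𝕃^B_i`. -/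
def lowerEnv (L W : ℕ) (B : ℕ → ℝ) (i : ℕ) : ℝ :=
  sInf (B '' Set.Icc (max 1 (i - W)) (min L (i + W)))

/-- LB_Keogh term `κ_i`. -/
def kappa (L W : ℕ) (A B : ℕ → ℝ) (i : ℕ) : ℝ :=
  if upperEnv L W B i < A i then delta (A i) (upperEnv L W B i)
  else if A i < lowerEnv L W B i then delta (A i) (lowerEnv L W B i)
  else 0
theorem delta_nonneg (x y : ℝ) : 0 ≤ delta x y := sq_nonneg _

theorem bandMin_le (A B : ℕ → ℝ) {s : Finset (ℕ × ℕ)} {q : ℕ × ℕ} (hq : q ∈ s) :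
    bandMin A B s ≤ delta (A q.1) (B q.2) := by
  refine csInf_le ⟨0, ?_⟩ ⟨q, hq, rfl⟩
  rintro _ ⟨r, -, rfl⟩
  exact delta_nonneg _ _

/-- A cell within the window lies in the right band of its smaller coordinate. -/
theorem mem_rightBand_min {L W : ℕ} {q : ℕ × ℕ} (h₁ : q.1 ≤ L) (h₂ : q.2 ≤ L)
    (hW : ((q.1 : ℤ) - (q.2 : ℤ)).natAbs ≤ W) : q ∈ rightBand L W (min q.1 q.2) := by
  obtain ⟨a, b⟩ := q
  simp only at h₁ h₂ hW
  rcases le_total a b with h | h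
  · simp only [rightBand, Finset.mem_union, Finset.mem_image, Finset.mem_Icc, min_eq_left h]
    exact Or.inr ⟨b, by omega, rfl⟩
  · simp only [rightBand, Finset.mem_union, Finset.mem_image, Finset.mem_Icc, min_eq_right h]
    exact Or.inl ⟨a, by omega, rfl⟩

/-- A step leaves the smaller coordinate unchanged or increases it by one. -/
theorem Step.min_eq_or {q r : ℕ × ℕ} (h : Step q r) :
    min r.1 r.2 = min q.1 q.2 ∨ min r.1 r.2 = min q.1 q.2 + 1 := by
  rcases h with rfl | rfl | rfl <;> simp only <;> omega

/-- The cost of a path from `q` to `(L, L)` bounds the right-band minima from the smaller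
coordinate of `q` onwards. -/
theorem sum_bandMin_rightBand_le_pathCost (L W : ℕ) (A B : ℕ → ℝ) (q : ℕ × ℕ)
    (t : List (ℕ × ℕ)) (hlast : (q :: t).getLast? = some (L, L))
    (hchain : List.IsChain Step (q :: t))
    (hmem : ∀ r ∈ q :: t, r.1 ≤ L ∧ r.2 ≤ L ∧ ((r.1 : ℤ) - (r.2 : ℤ)).natAbs ≤ W) :
    ∑ i ∈ Finset.Icc (min q.1 q.2) L, bandMin A B (rightBand L W i) ≤
      pathCost A B (q :: t) := by
  have hband {r : ℕ × ℕ} (hr : r.1 ≤ L ∧ r.2 ≤ L ∧ ((r.1 : ℤ) - (r.2 : ℤ)).natAbs ≤ W) :=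
    bandMin_le A B (mem_rightBand_min hr.1 hr.2.1 hr.2.2)
  induction t generalizing q with
  | nil =>
    obtain rfl : q = (L, L) := by simpa using hlast
    simpa [pathCost] using hband (hmem (L, L) (by simp))
  | cons r t ih =>
    rw [List.isChain_cons_cons] at hchain
    have hq := hmem q (by simp)
    have key := ih r (by simpa using hlast) hchain.2
      (fun x hx => hmem x (List.mem_cons_of_mem _ hx))
    have hcost : pathCost A B (q :: r :: t) =
        delta (A q.1) (B q.2) + pathCost A B (r :: t) := by
      simp [pathCost]
    rw [hcost]
    rcases hchain.1.min_eq_or with h | h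
    · rw [h] at key
      linarith [delta_nonneg (A q.1) (B q.2)]
    · rw [h] at key
      rw [← Finset.insert_Icc_add_one_left_eq_Icc (show min q.1 q.2 ≤ L by omega),
        Finset.sum_insert (by rw [Finset.mem_Icc]; omega)]
      exact add_le_add (hband hq) key

/-- The diagonal is a warping path. -/
theorem exists_isWarpingPath {L : ℕ} (W : ℕ) (hL : 1 ≤ L) : ∃ p, IsWarpingPath L W p := by
  induction L, hL using Nat.le_induction with
  | base => exact ⟨[(1, 1)], rfl, rfl, List.isChain_singleton _, by simp⟩
  | succ n hn ih =>
    obtain ⟨p, hhead, hlast, hchain, hmem⟩ := ih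
    refine ⟨p ++ [(n + 1, n + 1)], by simp [List.head?_append, hhead], by simp, ?_, ?_⟩
    · refine List.IsChain.append hchain (List.isChain_singleton _) ?_
      simp [hlast, Step]
    · intro q hq
      rcases List.mem_append.1 hq with hq | hq
      · have := hmem q hq
        omega
      · obtain rfl : q = (n + 1, n + 1) := by simpa using hq
        simp

/-- The sum of right-band minima is a lower bound on `DTW²_W(A,B)`. -/
theorem rightBands_lower_bound (L W : ℕ) (hL : 1 ≤ L) (A B : ℕ → ℝ) :
    ∑ i ∈ Finset.Icc 1 L, bandMin A B (rightBand L W i) ≤ DTW2 L W A B := by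
  refine le_csInf (Set.Nonempty.image _ (exists_isWarpingPath W hL)) ?_
  rintro _ ⟨p, ⟨hhead, hlast, hchain, hmem⟩, rfl⟩
  obtain ⟨t, rfl⟩ := List.head?_eq_some_iff.1 hhead
  simpa using sum_bandMin_rightBand_le_pathCost L W A B (1, 1) t hlast hchain
    fun r hr => ⟨(hmem r hr).2.1, (hmem r hr).2.2.2.1, (hmem r hr).2.2.2.2⟩
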